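/- arXiv:2301.10627 — 3 statements merged into one kernel-verified Lean document; each statement's English description precedes it below -/
import Mathlib

section
/- Let W be a Coxeter group and * the Demazure (Hecke) product. For all v, w ∈ W: v*w = max{xw : x ≤ v and ℓ(xw) = ℓ(x) + ℓ(w)}, where the maximum is taken with respect to length, and this maximum is achieved. Moreover v*w = xw where x is the maximal-length element with x ≤ v and ℓ(xw) = ℓ(x) + ℓ(w). -/
/-- The strong Bruhat order: `u ≤ v` iff some reduced word for `v` has a subword
which is a word for `u`. -/
def bruhat {B W : Type*} [Group W] {M : CoxeterMatrix B} (cs : CoxeterSystem M W)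
    (u v : W) : Prop :=
  ∃ ω : List B, cs.IsReduced ω ∧ cs.wordProd ω = v ∧
    ∃ ω' : List B, ω'.Sublist ω ∧ cs.wordProd ω' = u

/-- `dem` is the Demazure (Hecke) product on the Coxeter group: it satisfies
`1 * u = u`, `s * u = max{u, su}` for simple reflections `s`, and is associative.
These properties characterize it. -/
def IsDemazureProduct {B W : Type*} [Group W] {M : CoxeterMatrix B}
    (cs : CoxeterSystem M W) (dem : W → W → W) : Prop :=
  (∀ u : W, dem 1 u = u) ∧
  (∀ (i : B) (u : W),
    dem (cs.simple i) u =
      if cs.length u < cs.length (cs.simple i * u) then cs.simple i * u else u) ∧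
  (∀ u v x : W, dem (dem u v) x = dem u (dem v x))

namespace DemProof
open CoxeterSystem

variable {B W : Type*} [Group W] {M : CoxeterMatrix B} (cs : CoxeterSystem M W)

open Classical in
/-- indicator in `ZMod 2` -/
noncomputable def ind (p : Prop) : ZMod 2 := if p then 1 else 0

theorem ind_congr {p q : Prop} (h : p ↔ q) : ind p = ind q := by
  rw [propext h]

/-- The basic involution. -/
noncomputable def eta (i : B) : Equiv.Perm (W × ZMod 2) :=
  Function.Involutive.toPerm
    (fun x => (cs.simple i * x.1 * cs.simple i, x.2 + ind (x.1 = cs.simple i)))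
    (by
      rintro ⟨t, e⟩
      have h : (cs.simple i * t * cs.simple i = cs.simple i) ↔ t = cs.simple i := by
        constructor
        · intro h
          have := congrArg (fun z => cs.simple i * z * cs.simple i) h
          simpa [mul_assoc] using this
        · rintro rfl; simp
      ext
      · simp [mul_assoc]
      · simp only [ind_congr h, add_assoc, CharTwo.add_self_eq_zero, add_zero])

theorem eta_apply (i : B) (t : W) (e : ZMod 2) :
    eta cs i (t, e) = (cs.simple i * t * cs.simple i, e + ind (t = cs.simple i)) := rfl

theorem eta_pow (i j : B) (p : ℕ) (t : W) (e : ZMod 2) :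
    ((eta cs i * eta cs j) ^ p) (t, e) =
      ((cs.simple i * cs.simple j) ^ p * t * ((cs.simple i * cs.simple j) ^ p)⁻¹,
        e + ∑ k ∈ Finset.range (2 * p),
          ind (t = (cs.simple j * cs.simple i) ^ k * cs.simple j)) := by
  induction p with
  | zero => simp
  | succ p ih =>
    have hinv : (cs.simple i * cs.simple j)⁻¹ = cs.simple j * cs.simple i := by simp
    have hc : cs.simple j * (cs.simple i * cs.simple j) ^ p
        = (cs.simple j * cs.simple i) ^ p * cs.simple j := by
      clear ih
      induction p with
      | zero => simp
      | succ p ih => rw [pow_succ, ← mul_assoc, ih, pow_succ]; simp [mul_assoc]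
    have h1 : ((cs.simple i * cs.simple j) ^ p * t * ((cs.simple i * cs.simple j) ^ p)⁻¹
        = cs.simple j) ↔ t = (cs.simple j * cs.simple i) ^ (2 * p) * cs.simple j := by
      rw [mul_inv_eq_iff_eq_mul, ← eq_inv_mul_iff_mul_eq, hc, ← inv_pow, hinv, two_mul, pow_add,
        mul_assoc]
    have h2 : (cs.simple j * ((cs.simple i * cs.simple j) ^ p * t *
        ((cs.simple i * cs.simple j) ^ p)⁻¹) * cs.simple j
        = cs.simple i) ↔ t = (cs.simple j * cs.simple i) ^ (2 * p + 1) * cs.simple j := by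
      have : cs.simple j * ((cs.simple i * cs.simple j) ^ p * t *
        ((cs.simple i * cs.simple j) ^ p)⁻¹) * cs.simple j = cs.simple i ↔
        (cs.simple i * cs.simple j) ^ p * t * ((cs.simple i * cs.simple j) ^ p)⁻¹
          = cs.simple j * cs.simple i * cs.simple j := by
        constructor
        · intro h
          have := congrArg (fun z => cs.simple j * z * cs.simple j) h
          simpa [mul_assoc] using this
        · intro h; rw [h]; simp [mul_assoc]
      rw [this, mul_inv_eq_iff_eq_mul, ← eq_inv_mul_iff_mul_eq, mul_assoc _ (cs.simple j), hc,
        ← inv_pow, hinv, two_mul, pow_succ, pow_add]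
      have h3 : cs.simple j * cs.simple i * (cs.simple j * cs.simple i) ^ p
        = (cs.simple j * cs.simple i) ^ p * (cs.simple j * cs.simple i) := by
        rw [← pow_succ, ← pow_succ']
      rw [← mul_assoc (cs.simple j * cs.simple i), h3]
      simp only [mul_assoc]
    rw [pow_succ', Equiv.Perm.mul_apply, ih, Equiv.Perm.mul_apply, eta_apply, eta_apply,
      ind_congr h1, ind_congr h2, show 2 * (p + 1) = 2 * p + 1 + 1 by ring,
      Finset.sum_range_succ, Finset.sum_range_succ]
    refine Prod.ext ?_ ?_
    · simp [pow_succ', mul_assoc]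
    · simp only [add_assoc]

theorem eta_liftable : M.IsLiftable (eta cs) := by
  intro i j
  ext1 ⟨t, e⟩
  rw [eta_pow, cs.simple_mul_simple_pow, two_mul, Finset.sum_range_add]
  have : ∀ k, (cs.simple j * cs.simple i) ^ (M i j + k) = (cs.simple j * cs.simple i) ^ k := by
    intro k
    rw [pow_add, cs.simple_mul_simple_pow', one_mul]
  simp only [this, CharTwo.add_self_eq_zero]
  simp

/-- The action of `W` on `W × ZMod 2`. -/
noncomputable def Phi : W →* Equiv.Perm (W × ZMod 2) := cs.lift ⟨eta cs, eta_liftable cs⟩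

theorem Phi_simple (i : B) : Phi cs (cs.simple i) = eta cs i :=
  cs.lift_apply_simple (eta_liftable cs) i

/-- The inversion cocycle. -/
noncomputable def nn (w t : W) : ZMod 2 := (Phi cs w (t, 0)).2

open Classical in
theorem Phi_word (ω : List B) (t : W) (e : ZMod 2) :
    Phi cs (cs.wordProd ω) (t, e) =
      (cs.wordProd ω * t * (cs.wordProd ω)⁻¹, e + ((cs.rightInvSeq ω).count t : ZMod 2)) := by
  induction ω with
  | nil => simp
  | cons i ω ih =>
    rw [wordProd_cons, map_mul, Equiv.Perm.mul_apply, ih, Phi_simple, eta_apply]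
    refine Prod.ext ?_ ?_
    · simp [mul_assoc]
    · simp only [rightInvSeq, List.count_cons, Nat.cast_add, add_assoc]
      congr 2
      unfold ind
      have : (cs.wordProd ω * t * (cs.wordProd ω)⁻¹ = cs.simple i) ↔
          ((cs.wordProd ω)⁻¹ * cs.simple i * cs.wordProd ω = t) := by
        rw [mul_inv_eq_iff_eq_mul, mul_assoc, inv_mul_eq_iff_eq_mul, eq_comm]
      simp only [this, beq_iff_eq]
      split_ifs <;> simp

theorem Phi_apply (w t : W) (e : ZMod 2) :
    Phi cs w (t, e) = (w * t * w⁻¹, e + nn cs w t) := by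
  classical
  obtain ⟨ω, -, rfl⟩ := cs.exists_isReduced w
  unfold nn
  rw [Phi_word, Phi_word]; simp

theorem nn_mul (a b t : W) : nn cs (a * b) t = nn cs b t + nn cs a (b * t * b⁻¹) := by
  have := Phi_apply cs (a * b) t 0
  rw [map_mul, Equiv.Perm.mul_apply, Phi_apply, Phi_apply] at this
  simpa using (congrArg Prod.snd this).symm

theorem nn_one (t : W) : nn cs 1 t = 0 := by simp [nn]

theorem nn_simple (i : B) (t : W) : nn cs (cs.simple i) t = ind (t = cs.simple i) := by
  simp [nn, Phi_simple, eta_apply]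

theorem nn_self {t : W} (ht : cs.IsReflection t) : nn cs t t = 1 := by
  obtain ⟨g, i, rfl⟩ := ht
  have h0 := nn_mul cs g g⁻¹ (g * cs.simple i * g⁻¹)
  rw [mul_inv_cancel, nn_one] at h0
  have e1 : g⁻¹ * (g * cs.simple i * g⁻¹) * g⁻¹⁻¹ = cs.simple i := by group
  rw [e1] at h0
  conv_lhs => rw [nn_mul, nn_mul, e1]
  rw [nn_simple]
  have e2 : cs.simple i * cs.simple i * (cs.simple i)⁻¹ = cs.simple i := by simp
  rw [e2]
  have : ind (cs.simple i = cs.simple i) = 1 := by simp [ind]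
  rw [this]
  linear_combination -h0

theorem lt_of_nn {w t : W} (h : nn cs w t = 1) : cs.length (w * t) < cs.length w := by
  classical
  obtain ⟨ω, hω, rfl⟩ := cs.exists_isReduced w
  refine (cs.isRightInversion_of_mem_rightInvSeq hω (t := t) ?_).2
  by_contra hn
  have := Phi_word cs ω t 0
  rw [Phi_apply, h, List.count_eq_zero_of_not_mem hn] at this
  simp at this

theorem nn_iff {w t : W} (ht : cs.IsReflection t) :
    cs.length (w * t) < cs.length w ↔ nn cs w t = 1 := by
  refine ⟨fun h => ?_, lt_of_nn cs⟩
  by_contra hn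
  have h01 : ∀ z : ZMod 2, z ≠ 1 → z = 0 := by decide
  have h2 : nn cs (w * t) t = 1 := by
    rw [nn_mul, nn_self cs ht, mul_inv_cancel_right, h01 _ hn, add_zero]
  have := lt_of_nn cs h2
  rw [mul_assoc, ht.mul_self, mul_one] at this
  omega

theorem nn_iff_left {w t : W} (ht : cs.IsReflection t) :
    cs.length (t * w) < cs.length w ↔ nn cs w⁻¹ t = 1 := by
  rw [← nn_iff cs ht, ← cs.length_inv (t * w), mul_inv_rev, ht.inv, cs.length_inv w]

/-- An edge of the Bruhat graph. -/
def Edge (u v : W) : Prop := ∃ r, cs.IsReflection r ∧ v = r * u ∧ cs.length u < cs.length v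

/-- The Bruhat order as reachability. -/
def Le (u v : W) : Prop := Relation.ReflTransGen (Edge cs) u v

theorem Le.length {u v : W} (h : Le cs u v) : cs.length u ≤ cs.length v := by
  induction h with
  | refl => exact le_rfl
  | tail _ h ih => obtain ⟨_, _, _, h⟩ := h; omega

/-- One step of the Demazure product. -/
noncomputable def act (i : B) (u : W) : W :=
  if cs.length u < cs.length (cs.simple i * u) then cs.simple i * u else u

theorem le_act (i : B) (u : W) : Le cs u (act cs i u) := by
  unfold act
  split_ifs with h
  · exact .single ⟨_, cs.isReflection_simple i, rfl, h⟩
  · exact .refl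

theorem mul_le_act (i : B) (u : W) : Le cs (cs.simple i * u) (act cs i u) := by
  unfold act
  split_ifs with h
  · exact .refl
  · refine .single ⟨_, cs.isReflection_simple i, by simp, ?_⟩
    have := cs.length_simple_mul_ne u i
    omega

theorem edge_act (i : B) {u v : W} (h : Edge cs u v) : Le cs (act cs i u) (act cs i v) := by
  have h1 : Le cs u (act cs i v) := .head h (le_act cs i v)
  have h2 : Le cs (cs.simple i * u) (act cs i v) := by
    obtain ⟨r, hr, rfl, hl⟩ := h
    by_cases hrs : r = cs.simple i
    · rw [← hrs]; exact hrs ▸ le_act cs i _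
    · refine .head ?_ (mul_le_act cs i (r * u))
      have hr' := hr.conj (cs.simple i)
      refine ⟨_, hr', by simp [mul_assoc], ?_⟩
      have key : nn cs (cs.simple i * u)⁻¹ (cs.simple i * r * (cs.simple i)⁻¹) = nn cs u⁻¹ r := by
        rw [mul_inv_rev, nn_mul, cs.inv_simple, nn_simple]
        have e : ¬ (cs.simple i * r * cs.simple i = cs.simple i) := by
          intro h
          apply hrs
          have := congrArg (fun z => cs.simple i * z * cs.simple i) h
          simpa [mul_assoc] using this
        have e2 : cs.simple i * (cs.simple i * r * cs.simple i) * cs.simple i = r := by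
          simp [mul_assoc]
        rw [cs.inv_simple, e2]
        simp only [ind, if_neg e, zero_add]
      have h3 : ¬ nn cs u⁻¹ r = 1 := by rw [← nn_iff_left cs hr]; omega
      rw [← key, ← nn_iff_left cs hr'] at h3
      have h4 := hr'.length_mul_right_ne (cs.simple i * u)
      have h5 : cs.simple i * r * (cs.simple i)⁻¹ * (cs.simple i * u) = cs.simple i * (r * u) := by
        simp [mul_assoc]
      rw [h5] at h3 h4
      omega
  by_cases hc : cs.length u < cs.length (cs.simple i * u)
  · have : act cs i u = cs.simple i * u := if_pos hc
    rwa [this]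
  · have : act cs i u = u := if_neg hc
    rwa [this]

theorem le_act_act (i : B) {u v : W} (h : Le cs u v) : Le cs (act cs i u) (act cs i v) := by
  induction h with
  | refl => exact .refl
  | tail _ h ih => exact ih.trans (edge_act cs i h)

theorem sub_le {ω' ω : List B} (h : ω'.Sublist ω) (w : W) :
    Le cs (cs.wordProd ω' * w) (ω.foldr (act cs) w) := by
  induction h with
  | slnil => simp only [wordProd_nil, one_mul, List.foldr_nil]; exact .refl
  | cons i _ ih => exact ih.trans (le_act cs i _)
  | cons_cons i _ ih =>
    rw [wordProd_cons, mul_assoc]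
    exact (mul_le_act cs i _).trans (le_act_act cs i ih)

theorem exists_sub (ω : List B) (w : W) : ∃ ω' : List B, ω'.Sublist ω ∧
    cs.length (cs.wordProd ω' * w) = cs.length (cs.wordProd ω') + cs.length w ∧
    ω.foldr (act cs) w = cs.wordProd ω' * w := by
  induction ω with
  | nil => exact ⟨[], by simp⟩
  | cons i ω ih =>
    obtain ⟨ω', hs, hl, he⟩ := ih
    rw [List.foldr_cons, he]
    unfold act
    split_ifs with hc
    · refine ⟨i :: ω', hs.cons_cons i, ?_, by rw [wordProd_cons, mul_assoc]⟩
      rw [wordProd_cons, mul_assoc]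
      have h1 := cs.length_mul_le (cs.simple i * cs.wordProd ω') w
      have h2 := cs.length_mul_le (cs.simple i) (cs.wordProd ω')
      rw [cs.length_simple] at h2
      rw [mul_assoc] at h1
      omega
    · exact ⟨ω', hs.cons i, hl, rfl⟩

theorem dem_eq {dem : W → W → W} (hdem : IsDemazureProduct cs dem) (ω : List B)
    (hω : cs.IsReduced ω) (w : W) : dem (cs.wordProd ω) w = ω.foldr (act cs) w := by
  obtain ⟨h1, h2, h3⟩ := hdem
  induction ω with
  | nil => simp [h1]
  | cons i ω ih =>
    have hr : cs.IsReduced ω := by simpa using hω.drop 1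
    have hl : cs.length (cs.wordProd ω) < cs.length (cs.simple i * cs.wordProd ω) := by
      rw [← wordProd_cons, hω.eq, hr.eq]; simp
    have := h2 i (cs.wordProd ω)
    rw [if_pos hl] at this
    rw [wordProd_cons, ← this, h3, ih hr, h2]
    rfl

end DemProof

/-- For all `v, w`: `v*w = max{xw : x ≤ v, ℓ(xw) = ℓ(x) + ℓ(w)}` (maximum w.r.t.
length, and achieved), and moreover `v*w = xw` where `x` is the maximal-length
element with `x ≤ v` and `ℓ(xw) = ℓ(x) + ℓ(w)`. -/
theorem stmt3 {B W : Type*} [Group W] {M : CoxeterMatrix B} (cs : CoxeterSystem M W)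
    (dem : W → W → W) (hdem : IsDemazureProduct cs dem) (v w : W) :
    ∃ x : W, bruhat cs x v ∧
      cs.length (x * w) = cs.length x + cs.length w ∧
      dem v w = x * w ∧
      (∀ x' : W, bruhat cs x' v → cs.length (x' * w) = cs.length x' + cs.length w →
        cs.length (x' * w) ≤ cs.length (dem v w)) ∧
      (∀ x' : W, bruhat cs x' v → cs.length (x' * w) = cs.length x' + cs.length w →
        cs.length x' ≤ cs.length x) := by
  obtain ⟨ω, hω, rfl⟩ := cs.exists_isReduced v
  obtain ⟨ω', hs, hl, he⟩ := DemProof.exists_sub cs ω w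
  have hd : dem (cs.wordProd ω) w = cs.wordProd ω' * w := (DemProof.dem_eq cs hdem ω hω w).trans he
  have key : ∀ x' : W, bruhat cs x' (cs.wordProd ω) →
      cs.length (x' * w) ≤ cs.length (dem (cs.wordProd ω) w) := by
    rintro x' ⟨ρ, hρ, hρe, ρ', hρs, rfl⟩
    rw [← hρe, DemProof.dem_eq cs hdem ρ hρ w]
    exact (DemProof.sub_le cs hρs w).length
  refine ⟨cs.wordProd ω', ⟨ω, hω, rfl, ω', hs, rfl⟩, hl, hd, fun x' hx _ => key x' hx, ?_⟩
  intro x' hx hx'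
  have := key x' hx
  rw [hd] at this
  omega
end

section
/- Let W be a finite Coxeter group with longest element w₀. Fix w ∈ W, and for any v ∈ W let v_w denote the unique element of maximal length in {x : x ≤_R v and x ≤ w}. Then v_w = (vw₀)·((w₀v⁻¹) * w), where * is the Demazure product. -/
/-- The right weak Bruhat order: `u ≤_R v` iff `ℓ(u) + ℓ(u⁻¹v) = ℓ(v)`. -/
def rWeak {B W : Type*} [Group W] {M : CoxeterMatrix B} (cs : CoxeterSystem M W)
    (u v : W) : Prop :=
  cs.length u + cs.length (u⁻¹ * v) = cs.length v

namespace DemAux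

open CoxeterSystem

variable {B W : Type*} [Group W] {M : CoxeterMatrix B} (cs : CoxeterSystem M W)

/-- The action of a simple reflection on `W × ZMod 2`. -/
noncomputable def act (i : B) : Function.End (W × ZMod 2) := by
  classical
  exact fun p => (cs.simple i * p.1 * cs.simple i, p.2 + if p.1 = cs.simple i then 1 else 0)

open Classical in
lemma act_apply (i : B) (t : W) (e : ZMod 2) :
    act cs i (t, e) = (cs.simple i * t * cs.simple i, e + if t = cs.simple i then 1 else 0) := by
  simp only [act]

open Classical in
lemma act_pow (i j : B) (k : ℕ) (t : W) (e : ZMod 2) :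
    ((act cs i * act cs j) ^ k) (t, e) =
      ((cs.simple i * cs.simple j) ^ k * t * ((cs.simple i * cs.simple j) ^ k)⁻¹,
        e + ∑ l ∈ Finset.range (2 * k),
          if t = cs.simple j * (cs.simple i * cs.simple j) ^ l then 1 else 0) := by
  have hi := cs.simple_mul_simple_self i
  have hj := cs.simple_mul_simple_self j
  have key : ∀ l : ℕ, (cs.simple i * cs.simple j) ^ l * cs.simple j * (cs.simple i * cs.simple j) ^ l
      = cs.simple j := by
    intro l
    induction l with
    | zero => simp
    | succ l ih =>
      have hh : (cs.simple i * cs.simple j) * cs.simple j * (cs.simple i * cs.simple j)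
        = cs.simple j := by simp [mul_assoc]
      calc (cs.simple i * cs.simple j) ^ (l+1) * cs.simple j * (cs.simple i * cs.simple j) ^ (l+1)
          = (cs.simple i * cs.simple j) ^ l * ((cs.simple i * cs.simple j) * cs.simple j * (cs.simple i * cs.simple j)) * (cs.simple i * cs.simple j) ^ l := by
            have e1 : ∀ c : W, c ^ (l + 1) * cs.simple j * c ^ (l + 1)
                = c ^ l * (c * cs.simple j * c) * c ^ l := by
              intro c
              nth_rewrite 1 [pow_succ]
              rw [pow_succ']
              simp only [mul_assoc]
            exact e1 _
        _ = _ := by rw [hh, ih]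
  induction k with
  | zero => simp; rfl
  | succ k ih =>
    have h1 : ((act cs i * act cs j) ^ (k+1)) (t, e) =
      act cs i (act cs j (((act cs i * act cs j) ^ k) (t, e))) := by
      rw [pow_succ']; rfl
    rw [h1, ih, act_apply, act_apply]
    set c := cs.simple i * cs.simple j with hc
    have e1 : (c ^ k * t * (c ^ k)⁻¹ = cs.simple j) ↔ t = cs.simple j * c ^ (2 * k) := by
      have := key k
      have h2 : cs.simple j * c ^ (2 * k) = (c ^ k)⁻¹ * cs.simple j * c ^ k := by
        rw [two_mul, pow_add, mul_assoc, eq_inv_mul_iff_mul_eq, ← mul_assoc, ← mul_assoc, this]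
      rw [h2]
      constructor
      · intro h; rw [← h]; group
      · intro h; rw [h]; group
    have e2 : (cs.simple j * (c ^ k * t * (c ^ k)⁻¹) * cs.simple j = cs.simple i) ↔
        t = cs.simple j * c ^ (2 * k + 1) := by
      have := key k
      have h2 : cs.simple j * c ^ (2 * k + 1) = (c ^ k)⁻¹ * (cs.simple j * cs.simple i * cs.simple j) * c ^ k := by
        rw [two_mul, add_assoc, pow_add, pow_succ, eq_comm, mul_assoc, inv_mul_eq_iff_eq_mul, ← mul_assoc (cs.simple j),
          ← mul_assoc (c ^ k), ← mul_assoc (c ^ k) (cs.simple j), this, ← pow_succ, pow_succ', hc]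
        simp only [mul_assoc]
      rw [h2]
      constructor
      · intro h; rw [← h]
        simp only [mul_assoc, cs.simple_mul_simple_cancel_left, hj]; group
      · intro h; rw [h]
        have : ∀ a b : W, cs.simple j * (a * (a⁻¹ * b * a) * a⁻¹) * cs.simple j = cs.simple j * b * cs.simple j := by intros; group
        rw [this]; simp [mul_assoc]
    rw [show 2 * (k + 1) = 2 * k + 1 + 1 from rfl, Finset.sum_range_succ, Finset.sum_range_succ]
    simp only [e1, e2]
    refine Prod.ext ?_ ?_
    · simp only [pow_succ', hc, mul_inv_rev, cs.inv_simple, mul_assoc]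
    · simp only [add_assoc]

lemma act_liftable : M.IsLiftable (act cs) := by
  classical
  intro i j
  funext p
  obtain ⟨t, e⟩ := p
  rw [act_pow, cs.simple_mul_simple_pow, two_mul, Finset.sum_range_add]
  have : ∀ x, (cs.simple i * cs.simple j) ^ (M i j + x) = (cs.simple i * cs.simple j) ^ x := by
    intro x; rw [pow_add, cs.simple_mul_simple_pow, one_mul]
  simp only [this, CharTwo.add_self_eq_zero]
  simp; rfl

/-- The action of `W` on `W × ZMod 2`. -/
noncomputable def Phi : W →* Function.End (W × ZMod 2) := cs.lift ⟨act cs, act_liftable cs⟩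

open Classical in
lemma Phi_word (ω : List B) (t : W) (e : ZMod 2) :
    Phi cs (cs.wordProd ω) (t, e) =
      (cs.wordProd ω * t * (cs.wordProd ω)⁻¹, e + ((cs.rightInvSeq ω).count t : ZMod 2)) := by
  induction ω with
  | nil => simp; rfl
  | cons i ω ih =>
    have h1 : Phi cs (cs.wordProd (i :: ω)) (t, e) = act cs i (Phi cs (cs.wordProd ω) (t, e)) := by
      rw [cs.wordProd_cons, map_mul]
      have : Phi cs (cs.simple i) = act cs i := cs.lift_apply_simple (act_liftable cs) i
      rw [this]; rfl
    rw [h1, ih, act_apply]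
    refine Prod.ext ?_ ?_
    · simp [cs.wordProd_cons, mul_assoc]
    · simp only [rightInvSeq, List.count_cons, beq_iff_eq]
      have : (cs.wordProd ω * t * (cs.wordProd ω)⁻¹ = cs.simple i) ↔
        ((cs.wordProd ω)⁻¹ * cs.simple i * cs.wordProd ω = t) := by
        constructor
        · intro h; rw [← h]; group
        · intro h; rw [← h]; group
      simp only [this]
      push_cast
      rw [add_assoc]

/-- Parity of the number of occurrences of `t` in the left inversion sequence. -/
noncomputable def par (w t : W) : ZMod 2 := (Phi cs w⁻¹ (t, 0)).2

open Classical in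
lemma par_word (ω : List B) (t : W) :
    par cs (cs.wordProd ω) t = ((cs.leftInvSeq ω).count t : ZMod 2) := by
  rw [par, ← cs.wordProd_reverse, Phi_word, rightInvSeq_reverse]
  simp

lemma Phi_inv (w t : W) (e : ZMod 2) :
    Phi cs w⁻¹ (t, e) = (w⁻¹ * t * w, e + par cs w t) := by
  classical
  obtain ⟨ω, rfl⟩ := cs.wordProd_surjective w
  rw [par, ← cs.wordProd_reverse, Phi_word, Phi_word]
  simp

lemma par_mul (u w t : W) : par cs (u * w) t = par cs u t + par cs w (u⁻¹ * t * u) := by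
  have h1 : Phi cs (u * w)⁻¹ (t, 0) = Phi cs w⁻¹ (Phi cs u⁻¹ (t, 0)) := by
    rw [mul_inv_rev, map_mul]; rfl
  rw [Phi_inv, Phi_inv, Phi_inv] at h1
  simpa using congrArg Prod.snd h1

lemma par_one (t : W) : par cs 1 t = 0 := by
  classical
  have := par_word cs [] t
  simpa using this

lemma par_simple (i : B) : par cs (cs.simple i) (cs.simple i) = 1 := by
  classical
  have := par_word cs [i] (cs.simple i)
  simpa using this

lemma par_refl {t : W} (ht : cs.IsReflection t) : par cs t t = 1 := by
  obtain ⟨u, i, rfl⟩ := ht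
  have h0 : par cs (u * u⁻¹) (u * cs.simple i * u⁻¹) = 0 := by
    rw [mul_inv_cancel, par_one]
  rw [par_mul] at h0
  rw [par_mul, par_mul]
  have a1 : u⁻¹ * (u * cs.simple i * u⁻¹) * u = cs.simple i := by group
  have a2 : (u * cs.simple i)⁻¹ * (u * cs.simple i * u⁻¹) * (u * cs.simple i) = cs.simple i := by
    group
  rw [a1] at h0 
  rw [a1, a2, par_simple, add_right_comm, h0, zero_add]

/-- Strong exchange. -/
lemma strong_exchange (ω : List B) {t : W} (ht : cs.IsReflection t)
    (hl : cs.length (t * cs.wordProd ω) < cs.length (cs.wordProd ω)) :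
    ∃ k, k < ω.length ∧ t * cs.wordProd ω = cs.wordProd (ω.eraseIdx k) := by
  classical
  have hmem : t ∈ cs.leftInvSeq ω := by
    by_contra hn
    have h0 : par cs (cs.wordProd ω) t = 0 := by
      rw [par_word, List.count_eq_zero_of_not_mem hn]; simp
    have h1 : par cs (t * cs.wordProd ω) t = 1 := by
      rw [par_mul, par_refl cs ht, inv_mul_cancel, one_mul, h0, add_zero]
    obtain ⟨ω', hr, hω'⟩ := cs.exists_isReduced (t * cs.wordProd ω)
    rw [hω', par_word] at h1
    have hm : t ∈ cs.leftInvSeq ω' := by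
      by_contra hn'
      rw [List.count_eq_zero_of_not_mem hn'] at h1
      simp at h1
    have h2 := (cs.isLeftInversion_of_mem_leftInvSeq hr hm).2
    rw [← hω', ← mul_assoc, ht.mul_self, one_mul] at h2
    omega
  obtain ⟨k, hk, rfl⟩ := List.getElem_of_mem hmem
  refine ⟨k, by simpa using hk, ?_⟩
  rw [← cs.getD_leftInvSeq_mul_wordProd, List.getD_eq_getElem _ _ hk]

/-- Exchange, for a reduced prefix. -/
lemma exchange_append (i : B) (ξ ω : List B) (hξ : cs.IsReduced (i :: ξ))
    (hl : cs.length (cs.simple i * (cs.wordProd (ξ ++ ω))) < cs.length (cs.wordProd (ξ ++ ω))) :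
    ∃ k, k < ω.length ∧ cs.wordProd (ξ ++ ω) = cs.wordProd (i :: ξ ++ ω.eraseIdx k) := by
  obtain ⟨k, hk, h⟩ := strong_exchange cs (ξ ++ ω) (cs.isReflection_simple i) hl
  by_cases hkx : k < ξ.length
  · exfalso
    rw [List.eraseIdx_append_of_lt_length hkx, cs.wordProd_append, cs.wordProd_append, ← mul_assoc,
      mul_left_inj, ← cs.wordProd_cons] at h
    have h1 := hξ.eq
    rw [h] at h1
    have h2 := cs.length_wordProd_le (ξ.eraseIdx k)
    rw [List.length_eraseIdx_of_lt hkx] at h2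
    simp at h1
    omega
  · push Not at hkx
    refine ⟨k - ξ.length, ?_, ?_⟩
    · simp at hk; omega
    · rw [List.eraseIdx_append_of_length_le hkx] at h
      rw [List.cons_append, cs.wordProd_cons, ← h, cs.simple_mul_simple_cancel_left]

lemma isReduced_tail {i : B} {ξ : List B} (h : cs.IsReduced (i :: ξ)) : cs.IsReduced ξ := by
  simpa using h.drop 1

lemma long_prefix (w₀ : W) (hlong : ∀ u : W, cs.length u ≤ cs.length w₀) (ξ : List B)
    (hξ : cs.IsReduced ξ) :
    ∃ ω : List B, cs.wordProd (ξ ++ ω) = w₀ ∧ (ξ ++ ω).length = cs.length w₀ := by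
  induction ξ with
  | nil =>
    obtain ⟨ω, hr, h⟩ := cs.exists_isReduced w₀
    exact ⟨ω, h.symm, by rw [h]; exact hr.eq.symm⟩
  | cons i ξ ih =>
    obtain ⟨ω, h1, h2⟩ := ih (isReduced_tail cs hξ)
    have hl : cs.length (cs.simple i * (cs.wordProd (ξ ++ ω))) < cs.length (cs.wordProd (ξ ++ ω)) := by
      rw [h1]
      exact lt_of_le_of_ne (hlong _) (cs.length_simple_mul_ne _ _)
    obtain ⟨k, hk, h⟩ := exchange_append cs i ξ ω hξ hl
    refine ⟨ω.eraseIdx k, by rw [← h, h1], ?_⟩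
    rw [← h2]
    simp [List.length_eraseIdx_of_lt hk]
    omega

lemma long_add (w₀ : W) (hlong : ∀ u : W, cs.length u ≤ cs.length w₀) (u : W) :
    cs.length u + cs.length (u⁻¹ * w₀) = cs.length w₀ := by
  obtain ⟨ξ, hr, rfl⟩ := cs.exists_isReduced u
  obtain ⟨ω, h1, h2⟩ := long_prefix cs w₀ hlong ξ hr
  have h3 : (cs.wordProd ξ)⁻¹ * w₀ = cs.wordProd ω := by
    rw [← h1, cs.wordProd_append, inv_mul_cancel_left]
  have h4 := cs.length_wordProd_le ω
  have h5 := cs.length_mul_le (cs.wordProd ξ) (cs.wordProd ω)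
  rw [← cs.wordProd_append, h1] at h5
  rw [h3]
  have := hr.eq
  simp at h2
  omega

lemma long_sq (w₀ : W) (hlong : ∀ u : W, cs.length u ≤ cs.length w₀) : w₀ * w₀ = 1 := by
  have := long_add cs w₀ hlong w₀⁻¹
  rw [cs.length_inv, inv_inv] at this
  rw [← cs.length_eq_zero_iff]; omega

lemma long_add' (w₀ : W) (hlong : ∀ u : W, cs.length u ≤ cs.length w₀) (u : W) :
    cs.length u + cs.length (w₀ * u) = cs.length w₀ := by
  have := long_add cs w₀ hlong u
  rw [← cs.length_inv (u⁻¹ * w₀), mul_inv_rev, inv_inv,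
    inv_eq_of_mul_eq_one_left (long_sq cs w₀ hlong)] at this
  exact this

/-- One step of the Bruhat graph. -/
def step (u y : W) : Prop := ∃ t, cs.IsReflection t ∧ y = t * u ∧ cs.length u < cs.length y

/-- The Bruhat order defined by chains of reflections. -/
def chain (u y : W) : Prop := Relation.ReflTransGen (step cs) u y

lemma chain_length {u y : W} (h : chain cs u y) :
    u = y ∨ cs.length u < cs.length y := by
  induction h with
  | refl => exact Or.inl rfl
  | tail _ hs ih =>
    obtain ⟨t, _, _, hlt⟩ := hs
    rcases ih with rfl | ih
    · exact Or.inr hlt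
    · exact Or.inr (ih.trans hlt)

/-- Demazure product with a simple reflection. -/
noncomputable def up (i : B) (u : W) : W :=
  if cs.length u < cs.length (cs.simple i * u) then cs.simple i * u else u

lemma chain_up (i : B) (u : W) : chain cs u (up cs i u) := by
  unfold up
  split_ifs with h
  · exact Relation.ReflTransGen.single ⟨_, cs.isReflection_simple i, rfl, h⟩
  · exact Relation.ReflTransGen.refl

lemma simple_chain_up (i : B) (u : W) : chain cs (cs.simple i * u) (up cs i u) := by
  unfold up
  split_ifs with h
  · exact Relation.ReflTransGen.refl
  · refine Relation.ReflTransGen.single ⟨_, cs.isReflection_simple i, ?_, ?_⟩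
    · simp
    · have := cs.length_simple_mul_ne u i
      omega

lemma step_lift (i : B) {u y : W} (h : step cs u y) :
    chain cs (cs.simple i * u) (up cs i y) := by
  obtain ⟨t, ht, rfl, hl⟩ := h
  set y := t * u with hy
  have hu : u = t * y := by rw [hy, ← mul_assoc, ht.mul_self, one_mul]
  have hrefl : cs.IsReflection (cs.simple i * t * cs.simple i) := by
    have := ht.conj (cs.simple i)
    rwa [cs.inv_simple] at this
  have heq : cs.simple i * y = cs.simple i * t * cs.simple i * (cs.simple i * u) := by
    simp [hy, mul_assoc]
  by_cases hd : cs.length y < cs.length (cs.simple i * y)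
  · refine Relation.ReflTransGen.single ⟨_, hrefl, ?_, ?_⟩
    · rw [up, if_pos hd, heq]
    · rw [up, if_pos hd]
      have h1 := cs.length_simple_mul u i
      have h2 := cs.length_simple_mul y i
      omega
  · have hup : up cs i y = y := if_neg hd
    obtain ⟨ω, hr, hω⟩ := cs.exists_isReduced (cs.simple i * y)
    have hyw : y = cs.wordProd (i :: ω) := by
      rw [cs.wordProd_cons, ← hω, cs.simple_mul_simple_cancel_left]
    obtain ⟨k, hk, hh⟩ := strong_exchange cs (i :: ω) ht (by
      rw [← hyw, ← hu]; exact hl)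
    rw [← hyw, ← hu] at hh
    cases k with
    | zero =>
      simp only [List.eraseIdx_cons_zero] at hh
      rw [hh, ← hω, cs.simple_mul_simple_cancel_left, hup]
      exact Relation.ReflTransGen.refl
    | succ k =>
      simp only [List.length_cons, Nat.add_lt_add_iff_right] at hk
      rw [List.eraseIdx_cons_succ, cs.wordProd_cons] at hh
      have hsu : cs.simple i * u = cs.wordProd (ω.eraseIdx k) := by
        rw [hh, cs.simple_mul_simple_cancel_left]
      have hlen := cs.length_wordProd_le (ω.eraseIdx k)
      rw [← hsu, List.length_eraseIdx_of_lt hk] at hlen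
      have h1 : step cs (cs.simple i * u) (cs.simple i * y) := by
        refine ⟨_, hrefl, heq, ?_⟩
        have := hr.eq
        rw [← hω] at this
        omega
      exact Relation.ReflTransGen.trans (Relation.ReflTransGen.single h1) (simple_chain_up cs i y)

lemma up_chain_of_chain (i : B) {a b : W} (h1 : chain cs a b) (h2 : chain cs (cs.simple i * a) b) :
    chain cs (up cs i a) b := by
  unfold up
  split_ifs
  · exact h2
  · exact h1

lemma chain_lift (i : B) {u y : W} (h : chain cs u y) :
    chain cs (cs.simple i * u) (up cs i y) := by
  induction h with
  | refl => exact simple_chain_up cs i u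
  | @tail b c hb hs ih =>
    refine Relation.ReflTransGen.trans ih (up_chain_of_chain cs i ?_ (step_lift cs i hs))
    exact Relation.ReflTransGen.trans (Relation.ReflTransGen.single hs) (chain_up cs i c)

/-- The Demazure product of a word with an element. -/
noncomputable def dw (ξ : List B) (u : W) : W := ξ.foldr (up cs) u

lemma chain_dw {ω' ω : List B} (h : ω'.Sublist ω) :
    chain cs (cs.wordProd ω') (dw cs ω 1) := by
  induction h with
  | slnil => simp only [dw, List.foldr_nil, wordProd_nil]; exact Relation.ReflTransGen.refl
  | @cons l₁ l₂ a h ih =>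
    exact Relation.ReflTransGen.trans ih (chain_up cs a _)
  | @cons_cons l₁ l₂ a h ih =>
    rw [cs.wordProd_cons]
    exact chain_lift cs a ih

lemma dw_reduced (ω : List B) (h : cs.IsReduced ω) : dw cs ω 1 = cs.wordProd ω := by
  induction ω with
  | nil => simp [dw]
  | cons i ω ih =>
    have h1 := ih (isReduced_tail cs h)
    have h2 : dw cs (i :: ω) 1 = up cs i (dw cs ω 1) := rfl
    have h3 := h.eq
    have h4 := (isReduced_tail cs h).eq
    rw [h2, h1, up, if_pos, cs.wordProd_cons]
    rw [← cs.wordProd_cons, h3, h4]; simp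

lemma dw_factor (ω : List B) (hω : cs.IsReduced ω) (ξ : List B) (hξ : cs.IsReduced ξ) :
    ∃ ω' : List B, ω'.Sublist ω ∧ dw cs ξ (cs.wordProd ω) = cs.wordProd (ξ ++ ω') ∧
      cs.IsReduced (ξ ++ ω') := by
  induction ξ with
  | nil => exact ⟨ω, List.Sublist.refl _, rfl, hω⟩
  | cons i ξ ih =>
    obtain ⟨ω', hs, he, hr⟩ := ih (isReduced_tail cs hξ)
    have h2 : dw cs (i :: ξ) (cs.wordProd ω) = up cs i (dw cs ξ (cs.wordProd ω)) := rfl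
    rw [h2, he]
    have hr' := hr.eq
    have h3 := cs.length_simple_mul (cs.wordProd (ξ ++ ω')) i
    by_cases hd : cs.length (cs.wordProd (ξ ++ ω')) < cs.length (cs.simple i * cs.wordProd (ξ ++ ω'))
    · refine ⟨ω', hs, ?_, ?_⟩
      · rw [up, if_pos hd, List.cons_append, cs.wordProd_cons]
      · rw [CoxeterSystem.IsReduced, List.cons_append, cs.wordProd_cons, List.length_cons]; omega
    · obtain ⟨k, hk, h⟩ := exchange_append cs i ξ ω' hξ (by omega)
      refine ⟨ω'.eraseIdx k, (List.eraseIdx_sublist _ _).trans hs, ?_, ?_⟩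
      · rw [up, if_neg hd, h]
      · rw [CoxeterSystem.IsReduced, ← h, hr']
        simp [List.length_eraseIdx_of_lt hk]
        omega

lemma dem_eq_dw (dem : W → W → W) (hdem : IsDemazureProduct cs dem) (ξ : List B)
    (hξ : cs.IsReduced ξ) (u : W) : dem (cs.wordProd ξ) u = dw cs ξ u := by
  obtain ⟨h1, h2, h3⟩ := hdem
  induction ξ with
  | nil => simp [dw, h1]
  | cons i ξ ih =>
    have hr := isReduced_tail cs hξ
    have h4 : dem (cs.simple i) (cs.wordProd ξ) = cs.wordProd (i :: ξ) := by
      rw [h2, if_pos, cs.wordProd_cons]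
      rw [← cs.wordProd_cons, hξ.eq, hr.eq]; simp
    rw [← h4, h3, ih hr, h2]
    simp only [dw, List.foldr_cons]
    conv_rhs => unfold up
    split_ifs <;> rfl

end DemAux

/-- Fix `w`. For any `v`, letting `v_w` be the unique maximal-length element of
`{x : x ≤_R v, x ≤ w}`, one has `v_w = (vw₀) · ((w₀v⁻¹) * w)` where `*` is the
Demazure product. -/
theorem stmt7 {B W : Type*} [Group W] {M : CoxeterMatrix B} (cs : CoxeterSystem M W)
    [Finite W] (w₀ : W) (hlong : ∀ u : W, cs.length u ≤ cs.length w₀)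
    (dem : W → W → W) (hdem : IsDemazureProduct cs dem)
    (w v vw : W)
    (hmem : rWeak cs vw v ∧ bruhat cs vw w)
    (hmax : ∀ x : W, rWeak cs x v → bruhat cs x w → cs.length x ≤ cs.length vw) :
    vw = (v * w₀) * dem (w₀ * v⁻¹) w := by
  obtain ⟨ξ, hξ, hx⟩ := cs.exists_isReduced (w₀ * v⁻¹)
  obtain ⟨hrw, ω, hω, hωw, ζ, hζ, hζv⟩ := hmem
  obtain ⟨ω', hs, he, hr⟩ := DemAux.dw_factor cs ω hω ξ hξ
  have hD : dem (w₀ * v⁻¹) w = cs.wordProd (ξ ++ ω') := by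
    rw [hx, DemAux.dem_eq_dw cs dem hdem ξ hξ, ← hωw, he]
  have hr' := hr.eq
  rw [cs.wordProd_append, List.length_append] at hr'
  have hlω' : cs.length (cs.wordProd ω') = ω'.length := by
    have h1 := cs.length_mul_le (cs.wordProd ξ) (cs.wordProd ω')
    have h2 := cs.length_wordProd_le ω'
    have h3 := hξ.eq
    omega
  have hξl := hξ.eq
  have hv := DemAux.long_add' cs w₀ hlong v⁻¹
  rw [hx, cs.length_inv] at hv
  have hadd : ∀ y : W, cs.length (v⁻¹ * y) + cs.length (cs.wordProd ξ * y) = cs.length w₀ := by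
    intro y
    rw [← hx, mul_assoc]
    exact DemAux.long_add' cs w₀ hlong _
  have hinv : ∀ y : W, cs.length (y⁻¹ * v) = cs.length (v⁻¹ * y) := by
    intro y
    rw [← cs.length_inv, mul_inv_rev, inv_inv]
  have hmem' : rWeak cs (cs.wordProd ω') v := by
    have := hadd (cs.wordProd ω')
    rw [rWeak, hinv]
    omega
  have hle := hmax _ hmem' ⟨ω, hω, hωw, ω', hs, rfl⟩
  have hch := DemAux.chain_dw cs ((List.Sublist.refl ξ).append hζ)
  have hdd : DemAux.dw cs (ξ ++ ω) 1 = cs.wordProd (ξ ++ ω') := by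
    rw [← he, ← DemAux.dw_reduced cs ω hω]
    simp [DemAux.dw]
  rw [hdd, cs.wordProd_append, cs.wordProd_append, hζv] at hch
  have hfin : cs.wordProd ξ * vw = cs.wordProd ξ * cs.wordProd ω' := by
    rcases DemAux.chain_length cs hch with h | h
    · exact h
    · exfalso
      have := hadd vw
      rw [rWeak, hinv] at hrw
      omega
  rw [hD, cs.wordProd_append, ← hfin, ← hx]
  have hsq := DemAux.long_sq cs w₀ hlong
  calc vw = v * (w₀ * w₀) * v⁻¹ * vw := by rw [hsq]; group
    _ = _ := by simp only [mul_assoc]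
end

section
/- Let W be a finite Coxeter group with longest element w₀. Fix w, v ∈ W and let v_w be the unique maximal-length element of {x : x ≤_R v, x ≤ w}. Then (v_w⁻¹v)⁻¹ w⁻¹ w₀ is the unique longest-length element of the set {x ∈ W : x ≤_L w⁻¹w₀ and x ≤ v⁻¹w₀}. -/
/-- The left weak Bruhat order: `u ≤_L v` iff `ℓ(vu⁻¹) + ℓ(u) = ℓ(v)`. -/
def lWeak {B W : Type*} [Group W] {M : CoxeterMatrix B} (cs : CoxeterSystem M W)
    (u v : W) : Prop :=
  cs.length (v * u⁻¹) + cs.length u = cs.length v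

namespace Stmt9Aux

open CoxeterSystem

variable {B W : Type*} [Group W] {M : CoxeterMatrix B} (cs : CoxeterSystem M W)

open Classical in
/-- The signed permutation attached to a simple reflection. -/
noncomputable def sgn (i : B) : Function.End (W × ZMod 2) :=
  fun p => (cs.simple i * p.1 * cs.simple i, p.2 + if p.1 = cs.simple i then 1 else 0)

theorem inv_pow_mul (i j : B) (k : ℕ) :
    ((cs.simple i * cs.simple j) ^ k)⁻¹ * cs.simple j
      = cs.simple j * (cs.simple i * cs.simple j) ^ k := by
  induction k with
  | zero => simp
  | succ k ih =>
    have h1 : ((cs.simple i * cs.simple j) ^ (k+1))⁻¹ =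
      (cs.simple j * cs.simple i) * ((cs.simple i * cs.simple j) ^ k)⁻¹ := by
      rw [pow_succ]; simp
    rw [h1, mul_assoc, ih, pow_succ']
    simp [mul_assoc]

open Classical in
theorem sgn_pow (i j : B) (k : ℕ) (t : W) (e : ZMod 2) :
    ((sgn cs i * sgn cs j) ^ k : Function.End (W × ZMod 2)) (t, e) =
      ((cs.simple i * cs.simple j) ^ k * t * ((cs.simple i * cs.simple j) ^ k)⁻¹,
        e + ∑ r ∈ Finset.range (2 * k),
          if t = cs.simple j * (cs.simple i * cs.simple j) ^ r then (1 : ZMod 2) else 0) := by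
  induction k with
  | zero => simp [Function.End.one_def]
  | succ k ih =>
    rw [pow_succ']
    change sgn cs i (sgn cs j (((sgn cs i * sgn cs j) ^ k : Function.End (W × ZMod 2)) (t, e))) = _
    rw [ih]
    have e2 : 2 * (k + 1) = 2 * k + 1 + 1 := by ring
    rw [e2, Finset.sum_range_succ, Finset.sum_range_succ]
    set c := cs.simple i * cs.simple j with hc
    have key := inv_pow_mul cs i j k
    rw [← hc] at key
    have a1 : (c ^ k * t * (c ^ k)⁻¹ = cs.simple j) ↔ t = cs.simple j * c ^ (2 * k) := by
      rw [two_mul, pow_add, ← mul_assoc, ← key]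
      constructor
      · intro h; rw [← h]; group
      · intro h; rw [h]; group
    have a2 : (cs.simple j * (c ^ k * t * (c ^ k)⁻¹) * cs.simple j = cs.simple i) ↔
        t = cs.simple j * c ^ (2 * k + 1) := by
      have e3 : cs.simple j * c ^ (2 * k + 1) = (c ^ k)⁻¹ * (cs.simple j * c) * c ^ k := by
        rw [← mul_assoc, key, show 2 * k + 1 = k + 1 + k by ring, pow_add, pow_add]
        simp [mul_assoc]
      rw [e3]
      have e4 : cs.simple j * c = cs.simple j * cs.simple i * cs.simple j := by
        rw [hc]; simp [mul_assoc]
      rw [e4]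
      constructor
      · intro h; rw [← h]; simp [mul_assoc]
      · intro h; rw [h]; simp [mul_assoc]
    simp only [sgn]
    simp only [a1, a2]
    ext
    · simp only [pow_succ' c k, mul_inv_rev]
      simp [hc, mul_assoc]
    · simp only [add_assoc]

theorem sgn_liftable : M.IsLiftable (sgn cs) := by
  classical
  intro i j
  funext ⟨t, e⟩
  rw [sgn_pow]
  rw [two_mul, Finset.sum_range_add]
  simp [pow_add, CharTwo.add_self_eq_zero, Function.End.one_def]

/-- The lifted signed-permutation representation. -/
noncomputable def Phi : W →* Function.End (W × ZMod 2) := cs.lift ⟨sgn cs, sgn_liftable cs⟩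

theorem Phi_simple (i : B) : Phi cs (cs.simple i) = sgn cs i :=
  cs.lift_apply_simple (sgn_liftable cs) i

open Classical in
theorem Phi_word (ω : List B) (t : W) (e : ZMod 2) :
    Phi cs (cs.wordProd ω) (t, e) =
      (cs.wordProd ω * t * (cs.wordProd ω)⁻¹, e + (List.count t (cs.rightInvSeq ω) : ZMod 2)) := by
  induction ω with
  | nil => simp [Function.End.one_def]
  | cons i ω ih =>
    rw [wordProd_cons, map_mul, Phi_simple]
    change sgn cs i (Phi cs (cs.wordProd ω) (t, e)) = _
    rw [ih]
    simp only [sgn, rightInvSeq, List.count_cons]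
    ext
    · simp [mul_assoc]
    · have : (cs.wordProd ω * t * (cs.wordProd ω)⁻¹ = cs.simple i) ↔
        ((cs.wordProd ω)⁻¹ * cs.simple i * cs.wordProd ω = t) := by
        constructor
        · intro h; rw [← h]; group
        · intro h; rw [← h]; group
      simp only [this, beq_iff_eq]
      push_cast
      rw [add_assoc]

/-- parity of inversion multiplicity -/
noncomputable def N (w t : W) : ZMod 2 := (Phi cs w (t, 0)).2

open Classical in
theorem N_word (ω : List B) (t : W) :
    N cs (cs.wordProd ω) t = (List.count t (cs.rightInvSeq ω) : ZMod 2) := by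
  simp [N, Phi_word]

theorem N_mul (x y t : W) : N cs (x * y) t = N cs y t + N cs x (y * t * y⁻¹) := by
  classical
  obtain ⟨a, rfl⟩ := cs.wordProd_surjective x
  obtain ⟨b, rfl⟩ := cs.wordProd_surjective y
  simp only [N, map_mul]
  change (Phi cs (cs.wordProd a) (Phi cs (cs.wordProd b) (t, 0))).2 = _
  simp only [Phi_word]
  simp

theorem N_simple (i : B) : N cs (cs.simple i) (cs.simple i) = 1 := by
  simp [N, Phi_simple, sgn]

theorem N_one (t : W) : N cs 1 t = 0 := by
  simp [N, Function.End.one_def]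

theorem N_self {t : W} (ht : cs.IsReflection t) : N cs t t = 1 := by
  obtain ⟨x, i, rfl⟩ := ht
  have h0 := N_mul cs x x⁻¹ (x * cs.simple i * x⁻¹)
  have h1 := N_mul cs (x * cs.simple i) x⁻¹ (x * cs.simple i * x⁻¹)
  have h2 := N_mul cs x (cs.simple i) (cs.simple i)
  have e : x⁻¹ * (x * cs.simple i * x⁻¹) * x⁻¹⁻¹ = cs.simple i := by group
  rw [e] at h0 h1
  rw [mul_inv_cancel, N_one] at h0
  rw [N_simple] at h2
  simp only [inv_simple, simple_mul_simple_cancel_right] at h2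
  rw [h1, h2]
  linear_combination -h0

theorem mem_ris {ω : List B} {t : W} (ht : cs.IsReflection t)
    (h : cs.length (cs.wordProd ω * t) < cs.length (cs.wordProd ω)) :
    t ∈ cs.rightInvSeq ω := by
  classical
  by_contra hn
  have h0 : N cs (cs.wordProd ω) t = 0 := by
    rw [N_word, List.count_eq_zero_of_not_mem hn]; simp
  have h1 := N_mul cs (cs.wordProd ω) t t
  rw [N_self cs ht, mul_inv_cancel_right, h0, add_zero] at h1
  obtain ⟨α, hα, hα'⟩ := cs.exists_isReduced (cs.wordProd ω * t)
  rw [hα', N_word] at h1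
  have hm : t ∈ cs.rightInvSeq α := by
    by_contra hn'
    rw [List.count_eq_zero_of_not_mem hn'] at h1
    simp at h1
  have := (cs.isRightInversion_of_mem_rightInvSeq hα hm).2
  rw [← hα', mul_assoc, ht.mul_self, mul_one] at this
  omega

theorem strong_exchange {ω : List B} {t : W} (ht : cs.IsReflection t)
    (h : cs.length (t * cs.wordProd ω) < cs.length (cs.wordProd ω)) :
    ∃ j < ω.length, t * cs.wordProd ω = cs.wordProd (ω.eraseIdx j) := by
  have h1 : t ∈ cs.rightInvSeq ω.reverse := by
    apply mem_ris cs ht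
    rw [wordProd_reverse]
    have : (cs.wordProd ω)⁻¹ * t = (t * cs.wordProd ω)⁻¹ := by simp [ht.inv]
    rw [this, length_inv, length_inv]
    exact h
  rw [rightInvSeq_reverse, List.mem_reverse] at h1
  obtain ⟨j, hj, rfl⟩ := List.mem_iff_getElem.mp h1
  refine ⟨j, by simpa using hj, ?_⟩
  rw [← List.getD_eq_getElem _ 1 hj, getD_leftInvSeq_mul_wordProd]

theorem exists_reduced_sublist (ω : List B) :
    ∃ ω', ω'.Sublist ω ∧ cs.IsReduced ω' ∧ cs.wordProd ω' = cs.wordProd ω := by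
  induction ω with
  | nil => exact ⟨[], List.Sublist.refl _, by simp [CoxeterSystem.IsReduced], rfl⟩
  | cons i ω ih =>
    obtain ⟨α, hs, hr, he⟩ := ih
    rcases cs.length_simple_mul (cs.wordProd α) i with h | h
    · refine ⟨i :: α, hs.cons_cons i, ?_, by simp [wordProd_cons, he]⟩
      rw [CoxeterSystem.IsReduced, wordProd_cons, h, hr.eq]; simp
    · obtain ⟨j, hj, hje⟩ := strong_exchange cs (ω := α) (cs.isReflection_simple i) (by omega)
      refine ⟨α.eraseIdx j, ((List.eraseIdx_sublist α j).trans hs).cons i, ?_, ?_⟩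
      · rw [CoxeterSystem.IsReduced, ← hje]
        have := List.length_eraseIdx_add_one hj
        have := hr.eq
        omega
      · rw [← hje, wordProd_cons, he]

theorem exchange_split {α β : List B} (i : B)
    (h : cs.length (cs.simple i * (cs.wordProd α * cs.wordProd β))
      < cs.length (cs.wordProd α * cs.wordProd β))
    (hα : cs.IsReduced (i :: α)) :
    ∃ j < β.length, cs.simple i * (cs.wordProd α * cs.wordProd β)
      = cs.wordProd α * cs.wordProd (β.eraseIdx j) := by
  rw [← wordProd_append] at h
  obtain ⟨j, hj, he⟩ := strong_exchange cs (cs.isReflection_simple i) h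
  rcases lt_or_ge j α.length with hl | hl
  · exfalso
    rw [List.eraseIdx_append_of_lt_length hl, wordProd_append, wordProd_append, ← mul_assoc] at he
    have he' := mul_right_cancel he
    have h1 := hα.eq
    rw [wordProd_cons, he'] at h1
    have h2 := cs.length_wordProd_le (α.eraseIdx j)
    have h3 := List.length_eraseIdx_add_one hl
    simp only [List.length_cons] at h1
    omega
  · rw [List.eraseIdx_append_of_length_le hl, wordProd_append, wordProd_append] at he
    rw [List.length_append] at hj
    exact ⟨j - α.length, by omega, he⟩

/-- One step of Bruhat order via reflections. -/
def Bst (a b : W) : Prop := ∃ t, cs.IsReflection t ∧ b = t * a ∧ cs.length a < cs.length b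

/-- Bruhat order via chains of reflections. -/
def Ble : W → W → Prop := Relation.ReflTransGen (Bst cs)

theorem Ble.trans' {a b c : W} (h : Ble cs a b) (h' : Ble cs b c) : Ble cs a c :=
  Relation.ReflTransGen.trans h h'

theorem step_simple {a b : W} (i : B) (h : Bst cs a b) :
    b = cs.simple i * a ∨ Bst cs (cs.simple i * a) (cs.simple i * b) := by
  obtain ⟨t, ht, rfl, hl⟩ := h
  by_cases hts : t = cs.simple i
  · left; rw [hts]
  right
  have hc : cs.IsReflection (cs.simple i * t * cs.simple i) := by
    have := ht.conj (cs.simple i); simpa using this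
  have e : cs.simple i * (t * a) = (cs.simple i * t * cs.simple i) * (cs.simple i * a) := by
    simp [mul_assoc]
  refine ⟨_, hc, e, ?_⟩
  by_contra hn
  have hne := hc.length_mul_right_ne (cs.simple i * a)
  rw [← e] at hne
  have hlt : cs.length (cs.simple i * (t * a)) < cs.length (cs.simple i * a) := by omega
  obtain ⟨α, hα, rfl⟩ := cs.exists_isReduced a
  have h1 := cs.length_simple_mul (cs.wordProd α) i
  have h2 := cs.length_simple_mul (t * cs.wordProd α) i
  have h3 := hlt
  rw [e, ← wordProd_cons] at h3
  obtain ⟨j, hj, he⟩ := strong_exchange cs hc h3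
  rw [wordProd_cons, ← e] at he
  cases j with
  | zero =>
    simp only [List.eraseIdx_cons_zero] at he
    apply hts
    have : cs.simple i * t = 1 := by
      apply mul_right_cancel (b := cs.wordProd α); rw [mul_assoc, he, one_mul]
    rw [mul_eq_one_iff_inv_eq] at this
    rw [← this, inv_simple]
  | succ j =>
    simp only [List.eraseIdx_cons_succ, wordProd_cons] at he
    have he' := mul_left_cancel he
    simp only [List.length_cons] at hj
    have h4 := cs.length_wordProd_le (α.eraseIdx j)
    have h5 := List.length_eraseIdx_add_one (l := α) (i := j) (by omega)
    have h6 := hα.eq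
    rw [he'] at hl
    omega

theorem Ble_simple_of_lt {a : W} {i : B} (h : cs.length a < cs.length (cs.simple i * a)) :
    Ble cs a (cs.simple i * a) :=
  Relation.ReflTransGen.single ⟨_, cs.isReflection_simple i, rfl, h⟩

theorem Ble_simple_of_gt {a : W} {i : B} (h : cs.length (cs.simple i * a) < cs.length a) :
    Ble cs (cs.simple i * a) a :=
  Relation.ReflTransGen.single ⟨_, cs.isReflection_simple i, by simp, h⟩

theorem lift1 {a b : W} (i : B) (h : Ble cs a b) :
    Ble cs (cs.simple i * a) b ∨ Ble cs (cs.simple i * a) (cs.simple i * b) := by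
  induction h with
  | refl => right; exact Relation.ReflTransGen.refl
  | tail hab hbc ih =>
    rcases ih with h | h
    · left; exact h.tail hbc
    · rcases step_simple cs i hbc with h' | h'
      · left; rw [h']; exact h
      · right; exact h.tail h'

theorem lift2 {a b : W} (i : B) (h : Ble cs a b) :
    Ble cs a (cs.simple i * b) ∨ Ble cs (cs.simple i * a) (cs.simple i * b) := by
  induction h using Relation.ReflTransGen.head_induction_on with
  | refl => right; exact Relation.ReflTransGen.refl
  | head hac hcb ih =>
    rcases ih with h | h
    · left; exact Relation.ReflTransGen.head hac h
    · rcases step_simple cs i hac with h' | h'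
      · left; rw [h'] at h; simpa using h
      · right; exact Relation.ReflTransGen.head h' h

theorem Ble_length {a b : W} (h : Ble cs a b) : a = b ∨ cs.length a < cs.length b := by
  induction h with
  | refl => left; rfl
  | tail hab hbc ih =>
    obtain ⟨t, ht, rfl, hl⟩ := hbc
    right
    rcases ih with rfl | h
    · exact hl
    · omega

theorem Ble_inv {a b : W} (h : Ble cs a b) : Ble cs a⁻¹ b⁻¹ := by
  induction h with
  | refl => exact Relation.ReflTransGen.refl
  | @tail b c hab hbc ih =>
    obtain ⟨t, ht, rfl, hl⟩ := hbc
    refine ih.tail ⟨b⁻¹ * t * b⁻¹⁻¹, ht.conj b⁻¹, ?_, ?_⟩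
    · simp [mul_assoc, ht.inv]
    · rw [length_inv, length_inv]; exact hl

theorem Ble_of_sublist {ω ω' : List B} (hω : cs.IsReduced ω) (hs : ω'.Sublist ω) :
    Ble cs (cs.wordProd ω') (cs.wordProd ω) := by
  induction hs with
  | slnil => exact Relation.ReflTransGen.refl
  | @cons l₁ l₂ i hs ih =>
    have h2 : cs.IsReduced l₂ := by simpa using hω.drop 1
    have h3 := hω.eq
    rw [wordProd_cons] at h3 ⊢
    refine Ble.trans' cs (ih h2) (Ble_simple_of_lt cs ?_)
    rw [h3, h2.eq]; simp
  | @cons_cons l₁ l₂ i hs ih =>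
    have h2 : cs.IsReduced l₂ := by simpa using hω.drop 1
    have h3 := hω.eq
    rw [wordProd_cons] at h3 ⊢
    rw [wordProd_cons]
    rcases lift1 cs i (ih h2) with h | h
    · refine Ble.trans' cs h (Ble_simple_of_lt cs ?_)
      rw [h3, h2.eq]; simp
    · exact h

theorem Ble_of_bruhat {a b : W} (h : bruhat cs a b) : Ble cs a b := by
  obtain ⟨ω, hω, rfl, ω', hs, rfl⟩ := h
  exact Ble_of_sublist cs hω hs

theorem bruhat_of_Ble {a b : W} (h : Ble cs a b) : bruhat cs a b := by
  obtain ⟨ω, hω, hb⟩ := cs.exists_isReduced b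
  refine ⟨ω, hω, hb.symm, ?_⟩
  suffices ∃ ω', ω'.Sublist ω ∧ cs.IsReduced ω' ∧ cs.wordProd ω' = a by
    obtain ⟨ω', h1, -, h2⟩ := this
    exact ⟨ω', h1, h2⟩
  induction h using Relation.ReflTransGen.head_induction_on with
  | refl => exact ⟨ω, List.Sublist.refl _, hω, hb.symm⟩
  | @head a c hac hcb ih =>
    obtain ⟨α, hs, hr, rfl⟩ := ih
    obtain ⟨t, ht, he, hl⟩ := hac
    have ha : a = t * cs.wordProd α := by rw [he, ← mul_assoc, ht.mul_self, one_mul]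
    rw [ha] at hl
    obtain ⟨j, hj, hje⟩ := strong_exchange cs ht hl
    obtain ⟨γ, g1, g2, g3⟩ := exists_reduced_sublist cs (α.eraseIdx j)
    exact ⟨γ, g1.trans ((List.eraseIdx_sublist α j).trans hs), g2, by rw [g3, ← hje, ha]⟩

open Classical in
/-- Greedy left factor extraction. -/
noncomputable def resid : List B → W → W
  | [], v => v
  | i :: ω, v => resid ω (if cs.length (cs.simple i * v) < cs.length v then cs.simple i * v else v)

theorem resid_factor (ω : List B) (v : W) :
    ∃ ω' : List B, ω'.Sublist ω ∧ v = cs.wordProd ω' * resid cs ω v ∧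
      cs.length v = ω'.length + cs.length (resid cs ω v) := by
  induction ω generalizing v with
  | nil => exact ⟨[], List.Sublist.refl _, by simp [resid], by simp [resid]⟩
  | cons i ω ih =>
    rw [resid]
    split_ifs with h
    · obtain ⟨α, h1, h2, h3⟩ := ih (cs.simple i * v)
      refine ⟨i :: α, h1.cons_cons i, ?_, ?_⟩
      · rw [wordProd_cons, mul_assoc, ← h2]; simp
      · have := cs.length_simple_mul v i
        simp only [List.length_cons]; omega
    · obtain ⟨α, h1, h2, h3⟩ := ih v
      exact ⟨α, h1.cons i, h2, h3⟩

theorem resid_le {ω ω' : List B} (hs : ω'.Sublist ω) {v q : W}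
    (h : Ble cs v (cs.wordProd ω' * q)) : Ble cs (resid cs ω v) q := by
  induction hs generalizing v with
  | slnil => simpa [resid] using h
  | @cons l₁ l₂ i hs ih =>
    rw [resid]
    apply ih
    split_ifs with hl
    · exact Ble.trans' cs (Ble_simple_of_gt cs hl) h
    · exact h
  | @cons_cons l₁ l₂ i hs ih =>
    rw [resid]
    apply ih
    rw [wordProd_cons, mul_assoc] at h
    have h2 := lift2 cs i h
    rw [simple_mul_simple_cancel_left] at h2
    have hne := cs.length_simple_mul_ne v i
    split_ifs with hl
    · rcases h2 with h2 | h2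
      · exact Ble.trans' cs (Ble_simple_of_gt cs hl) h2
      · exact h2
    · rcases h2 with h2 | h2
      · exact h2
      · exact Ble.trans' cs (Ble_simple_of_lt cs (by omega)) h2

theorem resid_main {ω : List B} (hω : cs.IsReduced ω) (v : W) :
    cs.length (cs.wordProd ω * resid cs ω v) = ω.length + cs.length (resid cs ω v) ∧
    Ble cs v (cs.wordProd ω * resid cs ω v) := by
  induction ω generalizing v with
  | nil => simp [resid]; exact Relation.ReflTransGen.refl
  | cons i ω ih =>
    have hω' : cs.IsReduced ω := by simpa using hω.drop 1
    rw [resid]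
    set v' := (if cs.length (cs.simple i * v) < cs.length v then cs.simple i * v else v) with hv'
    obtain ⟨ih1, ih2⟩ := ih hω' v'
    set q := resid cs ω v' with hq
    have hne := cs.length_simple_mul_ne v i
    have hasc : cs.length v' < cs.length (cs.simple i * v') := by
      rw [hv']; split_ifs with hl
      · simpa using hl
      · omega
    have hv : v = v' ∨ v = cs.simple i * v' := by
      rw [hv']; split_ifs with hl
      · right; simp
      · left; rfl
    have hup : cs.length (cs.wordProd ω * q) <
        cs.length (cs.simple i * (cs.wordProd ω * q)) := by
      by_contra hn
      have hne2 := cs.length_simple_mul_ne (cs.wordProd ω * q) i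
      have hlt : cs.length (cs.simple i * (cs.wordProd ω * q)) <
        cs.length (cs.wordProd ω * q) := by omega
      obtain ⟨β, hβ, hβq⟩ := cs.exists_isReduced q
      have hle : Ble cs v' (cs.simple i * (cs.wordProd ω * q)) := by
        rcases lift2 cs i ih2 with h | h
        · exact h
        · exact Ble.trans' cs (Ble_simple_of_lt cs hasc) h
      rw [hβq] at hlt
      obtain ⟨j, hj, hje⟩ := exchange_split cs i hlt hω
      rw [hβq, hje] at hle
      have h1 := resid_le cs (List.Sublist.refl ω) hle
      rw [← hq] at h1
      have h2 := cs.length_wordProd_le (β.eraseIdx j)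
      have h3 := List.length_eraseIdx_add_one hj
      have h4 := hβ.eq
      rw [← hβq] at h4
      rcases Ble_length cs h1 with h | h
      · rw [← h] at h2; omega
      · omega
    rw [wordProd_cons, mul_assoc]
    constructor
    · have := cs.length_simple_mul (cs.wordProd ω * q) i
      simp only [List.length_cons]; omega
    · have hb := Ble_simple_of_lt cs hup
      rcases hv with h | h
      · rw [h]; exact Ble.trans' cs ih2 hb
      · rw [h]
        rcases lift1 cs i ih2 with h' | h'
        · exact Ble.trans' cs h' hb
        · exact h'

theorem length_longest {w₀ : W} (hlong : ∀ u : W, cs.length u ≤ cs.length w₀) (u : W) :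
    cs.length u + cs.length (u⁻¹ * w₀) = cs.length w₀ := by
  obtain ⟨ω, hω, rfl⟩ := cs.exists_isReduced u
  induction ω with
  | nil => simp
  | cons i α ih =>
    have hα : cs.IsReduced α := by simpa using hω.drop 1
    have ih := ih hα
    obtain ⟨β, hβ, hβe⟩ := cs.exists_isReduced ((cs.wordProd α)⁻¹ * w₀)
    have hw : w₀ = cs.wordProd α * cs.wordProd β := by rw [← hβe]; simp
    have h1 := hlong (cs.simple i * w₀)
    have h2 := cs.length_simple_mul_ne w₀ i
    have h3 : cs.length (cs.simple i * w₀) < cs.length w₀ := by omega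
    rw [hw] at h3
    obtain ⟨j, hj, hje⟩ := exchange_split cs i h3 hω
    rw [← hw] at hje
    have e : (cs.wordProd (i :: α))⁻¹ * w₀ = cs.wordProd (β.eraseIdx j) := by
      rw [wordProd_cons, mul_inv_rev, inv_simple, mul_assoc, hje]; simp
    have h4 := cs.length_wordProd_le (β.eraseIdx j)
    have h5 := List.length_eraseIdx_add_one hj
    have h6 := cs.length_le_length_mul_add_left ((cs.wordProd (i :: α))⁻¹) w₀
    rw [length_inv] at h6
    rw [e] at h6 ⊢
    have h7 := hω.eq
    have h8 := hα.eq
    have h9 := hβ.eq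
    rw [← hβe] at h9
    simp only [List.length_cons] at h7
    omega

theorem Ble_w0 {w₀ : W} (hlong : ∀ u : W, cs.length u ≤ cs.length w₀) {a b : W}
    (h : Ble cs a b) : Ble cs (b * w₀) (a * w₀) := by
  have hl : ∀ u : W, cs.length u + cs.length (u * w₀) = cs.length w₀ := by
    intro u
    have := length_longest cs hlong u⁻¹
    rwa [inv_inv, length_inv] at this
  induction h with
  | refl => exact Relation.ReflTransGen.refl
  | @tail b c hab hbc ih =>
    obtain ⟨t, ht, rfl, hlt⟩ := hbc
    refine Relation.ReflTransGen.head ⟨t, ht, ?_, ?_⟩ ih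
    · rw [← mul_assoc, ← mul_assoc, ht.mul_self, one_mul]
    · have h1 := hl b
      have h2 := hl (t * b)
      omega

theorem Ble_w0_iff {w₀ : W} (hlong : ∀ u : W, cs.length u ≤ cs.length w₀) (v y : W) :
    Ble cs (y⁻¹ * w₀) (v⁻¹ * w₀) ↔ Ble cs v y := by
  have hw : w₀ * w₀ = 1 := by
    have := length_longest cs hlong w₀⁻¹
    rw [inv_inv, length_inv] at this
    rw [← cs.length_eq_zero_iff]; omega
  constructor
  · intro h
    have h1 := Ble_inv cs (Ble_w0 cs hlong h)
    rw [mul_assoc, mul_assoc, hw] at h1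
    simpa using h1
  · intro h
    exact Ble_w0 cs hlong (Ble_inv cs h)

end Stmt9Aux

/-- Fix `w, v` and let `v_w` be the unique maximal-length element of
`{x : x ≤_R v, x ≤ w}`.  Then `(v_w⁻¹ v)⁻¹ w⁻¹ w₀` is the unique longest-length
element of the set `{x : x ≤_L w⁻¹w₀ and x ≤ v⁻¹w₀}`. -/
theorem stmt9 {B W : Type*} [Group W] {M : CoxeterMatrix B} (cs : CoxeterSystem M W)
    [Finite W] (w₀ : W) (hlong : ∀ u : W, cs.length u ≤ cs.length w₀)
    (w v vw : W)
    (hmem : rWeak cs vw v ∧ bruhat cs vw w)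
    (hmax : ∀ x : W, rWeak cs x v → bruhat cs x w → cs.length x ≤ cs.length vw) :
    (lWeak cs ((vw⁻¹ * v)⁻¹ * (w⁻¹ * w₀)) (w⁻¹ * w₀) ∧
      bruhat cs ((vw⁻¹ * v)⁻¹ * (w⁻¹ * w₀)) (v⁻¹ * w₀)) ∧
    (∀ x : W, lWeak cs x (w⁻¹ * w₀) → bruhat cs x (v⁻¹ * w₀) →
      cs.length x ≤ cs.length ((vw⁻¹ * v)⁻¹ * (w⁻¹ * w₀))) ∧
    (∀ x : W, lWeak cs x (w⁻¹ * w₀) → bruhat cs x (v⁻¹ * w₀) →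
      cs.length x = cs.length ((vw⁻¹ * v)⁻¹ * (w⁻¹ * w₀)) →
      x = (vw⁻¹ * v)⁻¹ * (w⁻¹ * w₀)) := by
  obtain ⟨hr, ω, hω, rfl, ω', hs, rfl⟩ := hmem
  set w := cs.wordProd ω with hw
  set p := cs.wordProd ω' with hp
  set q := p⁻¹ * v with hq
  have hll := Stmt9Aux.length_longest cs hlong
  obtain ⟨r1, r2⟩ := Stmt9Aux.resid_main cs hω v
  have hpq : p * q = v := by rw [hq]; simp
  -- the complement `q` is the greedy residue
  have hqe : Stmt9Aux.resid cs ω v = q := by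
    have h1 : Stmt9Aux.Ble cs (Stmt9Aux.resid cs ω v) q := by
      apply Stmt9Aux.resid_le cs hs
      rw [← hp, hpq]
      exact Relation.ReflTransGen.refl
    obtain ⟨α, a1, a2, a3⟩ := Stmt9Aux.resid_factor cs ω v
    have a4 := cs.length_wordProd_le α
    have a5 := cs.length_mul_le (cs.wordProd α) (Stmt9Aux.resid cs ω v)
    rw [← a2] at a5
    have a6 : (cs.wordProd α)⁻¹ * v = Stmt9Aux.resid cs ω v := by
      rw [inv_mul_eq_iff_eq_mul]; exact a2
    have a7 := hmax (cs.wordProd α) (by unfold rWeak; rw [a6]; omega)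
      ⟨ω, hω, rfl, α, a1, rfl⟩
    unfold rWeak at hr
    rw [← hq] at hr
    rcases Stmt9Aux.Ble_length cs h1 with h | h
    · exact h
    · omega
  rw [hqe] at r1 r2
  rw [← hw] at r1 r2
  have hωl : cs.length w = ω.length := hω.eq
  have e1 : ∀ y : W, y⁻¹ * (w⁻¹ * w₀) = (w * y)⁻¹ * w₀ := by intro y; simp [mul_assoc]
  have e2 : w⁻¹ * w₀ * (q⁻¹ * (w⁻¹ * w₀))⁻¹ = q := by simp [mul_assoc]
  have l1 := hll (w * q)
  have l2 := hll w
  have aux : ∀ x : W, lWeak cs x (w⁻¹ * w₀) → bruhat cs x (v⁻¹ * w₀) →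
      x = q⁻¹ * (w⁻¹ * w₀) ∨ cs.length x < cs.length (q⁻¹ * (w⁻¹ * w₀)) := by
    intro x hx hb
    obtain ⟨y, rfl⟩ : ∃ y : W, x = y⁻¹ * (w⁻¹ * w₀) :=
      ⟨w⁻¹ * w₀ * x⁻¹, by simp [mul_assoc]⟩
    have e3 : w⁻¹ * w₀ * (y⁻¹ * (w⁻¹ * w₀))⁻¹ = y := by simp [mul_assoc]
    unfold lWeak at hx
    rw [e3] at hx
    have hb' := Stmt9Aux.Ble_of_bruhat cs hb
    rw [e1, Stmt9Aux.Ble_w0_iff cs hlong] at hb'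
    have h1 := Stmt9Aux.resid_le cs (List.Sublist.refl ω) hb'
    rw [hqe] at h1
    rcases Stmt9Aux.Ble_length cs h1 with h | h
    · left; rw [h]
    · right
      rw [e1 q]
      omega
  refine ⟨⟨?_, ?_⟩, ?_, ?_⟩
  · unfold lWeak
    rw [e2, e1]
    omega
  · apply Stmt9Aux.bruhat_of_Ble
    rw [e1, Stmt9Aux.Ble_w0_iff cs hlong]
    exact r2
  · intro x hx hb
    rcases aux x hx hb with h | h
    · rw [h]
    · exact h.le
  · intro x hx hb hl
    rcases aux x hx hb with h | h
    · exact h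
    · omega
end
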